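/- Let λ > 0, v > 0, t > 0. Then the p = 2 case of the general moment formula recovers the known second moment of the telegraph process: (vt)² (2/(λt))^{1/2} Γ(3/2) e^{−λt} ( I_{3/2}(λt) + I_{1/2}(λt) ) = (v²/λ) ( t − (1 − e^{−2λt})/(2λ) ). -/

import Mathlib

open Real

/-- The modified Bessel function of the first kind,
`I_ν(x) = ∑_{k=0}^∞ (x/2)^{2k+ν} / (Γ(k+1+ν) k!)`. -/
noncomputable def besselI (ν x : ℝ) : ℝ :=
  ∑' k : ℕ, (x / 2) ^ (2 * (k : ℝ) + ν) / (Real.Gamma ((k : ℝ) + 1 + ν) * (Nat.factorial k))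

lemma factorial_mul_Gamma_nat_add_three_halves (k : ℕ) :
    Real.Gamma ((k : ℝ) + 1 + 1 / 2) * (Nat.factorial k) =
      (Nat.factorial (2 * k + 1)) * √π / 2 ^ (2 * k + 1) := by
  have h := Real.Gamma_mul_Gamma_add_half ((k : ℝ) + 1)
  have h2 : 2 * ((k : ℝ) + 1) = ((2 * k + 1 : ℕ) : ℝ) + 1 := by push_cast; ring
  have h3 : 1 - (((2 * k + 1 : ℕ) : ℝ) + 1) = -((2 * k + 1 : ℕ) : ℝ) := by ring
  rw [h2, h3, Real.Gamma_nat_eq_factorial, Real.Gamma_nat_eq_factorial,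
    Real.rpow_neg zero_le_two, Real.rpow_natCast] at h
  rw [mul_comm, h]
  ring

lemma hasSum_besselI_one_half {x : ℝ} (hx : 0 < x) :
    HasSum (fun k : ℕ => (x / 2) ^ (2 * (k : ℝ) + 1 / 2) /
      (Real.Gamma ((k : ℝ) + 1 + 1 / 2) * (Nat.factorial k)))
      (2 * √(x / 2) / (√π * x) * Real.sinh x) := by
  have hπ : √π ≠ 0 := (Real.sqrt_pos.mpr Real.pi_pos).ne'
  refine ((Real.hasSum_sinh x).mul_left _).congr_fun ?_
  intro k
  have hf : ((2 * k + 1).factorial : ℝ) ≠ 0 := by positivity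
  have hp : (x / 2) ^ (2 * (k : ℝ) + 1 / 2) = (x / 2) ^ (2 * k) * √(x / 2) := by
    rw [Real.rpow_add (by positivity), Real.sqrt_eq_rpow, ← Real.rpow_natCast]
    push_cast
    rfl
  rw [hp, factorial_mul_Gamma_nat_add_three_halves, div_pow]
  field_simp
  ring

lemma hasSum_besselI_three_halves {x : ℝ} (hx : 0 < x) :
    HasSum (fun k : ℕ => (x / 2) ^ (2 * (k : ℝ) + 3 / 2) /
      (Real.Gamma ((k : ℝ) + 1 + 3 / 2) * (Nat.factorial k)))
      (2 * √(x / 2) / (√π * x) * (Real.cosh x - Real.sinh x / x)) := by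
  have hπ : √π ≠ 0 := (Real.sqrt_pos.mpr Real.pi_pos).ne'
  have h := (Real.hasSum_cosh x).sub ((Real.hasSum_sinh x).div_const x)
  rw [← hasSum_nat_add_iff' 1] at h
  have h0 : ∑ i ∈ Finset.range 1, (x ^ (2 * i) / ((2 * i).factorial : ℝ) -
      x ^ (2 * i + 1) / ((2 * i + 1).factorial : ℝ) / x) = 0 := by
    simp [hx.ne']
  rw [h0, sub_zero] at h
  refine (h.mul_left _).congr_fun ?_
  intro k
  have hf : ((2 * k + 1).factorial : ℝ) ≠ 0 := by positivity
  have hp : (x / 2) ^ (2 * (k : ℝ) + 3 / 2) = (x / 2) ^ (2 * k + 1) * √(x / 2) := by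
    rw [Real.sqrt_eq_rpow, ← Real.rpow_natCast, ← Real.rpow_add (by positivity)]
    push_cast
    congr 1
    ring
  have hk : (k : ℝ) + 1 + 1 / 2 ≠ 0 := by positivity
  have hg : Real.Gamma ((k : ℝ) + 1 + 3 / 2) =
      ((k : ℝ) + 1 + 1 / 2) * Real.Gamma ((k : ℝ) + 1 + 1 / 2) := by
    rw [← Real.Gamma_add_one hk]
    congr 1
    ring
  have h2 : ((2 * (k + 1)).factorial : ℝ) = (2 * k + 2) * (2 * k + 1).factorial := by
    rw [show 2 * (k + 1) = (2 * k + 1) + 1 by ring, Nat.factorial_succ]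
    push_cast
    ring
  have h3 : ((2 * (k + 1) + 1).factorial : ℝ) =
      (2 * k + 3) * ((2 * k + 2) * (2 * k + 1).factorial) := by
    rw [Nat.factorial_succ, Nat.cast_mul, h2]
    push_cast
    ring
  have hk2 : 2 * (k : ℝ) + 2 ≠ 0 := by positivity
  have hk3 : 2 * (k : ℝ) + 3 ≠ 0 := by positivity
  have hk' : (k : ℝ) + 1 + 1 / 2 = (2 * k + 3) / 2 := by ring
  rw [hp, hg, mul_assoc, factorial_mul_Gamma_nat_add_three_halves, hk', h2, h3, div_pow]
  field_simp
  ring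

/-- the `p = 2` case of the moment formula recovers the second moment:
`(vt)² (2/(λt))^{1/2} Γ(3/2) e^{−λt} (I_{3/2}(λt) + I_{1/2}(λt))
  = (v²/λ)(t − (1 − e^{−2λt})/(2λ))`. -/
theorem stmt_7 (l v t : ℝ) (hl : 0 < l) (hv : 0 < v) (ht : 0 < t) :
    (v * t) ^ 2 * (2 / (l * t)) ^ ((1 : ℝ) / 2) * Real.Gamma (3 / 2) *
        Real.exp (-(l * t)) * (besselI (3 / 2) (l * t) + besselI (1 / 2) (l * t))
      = (v ^ 2 / l) * (t - (1 - Real.exp (-(2 * l * t))) / (2 * l)) := by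
  obtain ⟨x, hx⟩ : ∃ x, x = l * t := ⟨_, rfl⟩
  have hx0 : 0 < x := hx ▸ mul_pos hl ht
  have hπ : √π ≠ 0 := (Real.sqrt_pos.mpr Real.pi_pos).ne'
  have h1 : besselI (1 / 2) x = _ := (hasSum_besselI_one_half hx0).tsum_eq
  have h3 : besselI (3 / 2) x = _ := (hasSum_besselI_three_halves hx0).tsum_eq
  have hΓ : Real.Gamma (3 / 2) = √π / 2 := by
    rw [show (3 / 2 : ℝ) = 1 / 2 + 1 by norm_num, Real.Gamma_add_one (by norm_num),
      Real.Gamma_one_half_eq]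
    ring
  have hs : √(2 / x) * √(x / 2) = 1 := by
    rw [← Real.sqrt_mul (by positivity), div_mul_div_cancel₀ hx0.ne', div_self two_ne_zero,
      Real.sqrt_one]
  have he : Real.exp (-x) * Real.exp x = 1 := by rw [← Real.exp_add]; simp
  have he2 : Real.exp (-(2 * l * t)) = Real.exp (-x) * Real.exp (-x) := by
    rw [← Real.exp_add, hx]
    congr 1
    ring
  rw [← hx, h1, h3, hΓ, ← Real.sqrt_eq_rpow, he2]
  calc _ = (v * t) ^ 2 * (√(2 / x) * √(x / 2)) / x *
        (Real.exp (-x) * (Real.cosh x + Real.sinh x) - Real.exp (-x) * Real.sinh x / x) := by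
        field_simp
        ring
    _ = (v * t) ^ 2 / x * (1 - (1 - Real.exp (-x) * Real.exp (-x)) / (2 * x)) := by
        rw [hs, Real.cosh_add_sinh, he, Real.sinh_eq]
        linear_combination (-(v * t) ^ 2 / x / (2 * x)) * he
    _ = _ := by
        generalize Real.exp (-x) = y
        subst hx
        field_simp
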